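/- (Extension of the class of test functions.) Let μ > 0, ε > 0 fixed, T > 0, and let f_ε ∈ C([0,T]; 𝓜^I₊) be a weak solution of the ε-fusion coagulation problem satisfying sup_{t∈[0,T]} ∫ (a^{μ+2} + v^{max{σ(μ+2), 2}} + v^{min{σ(μ+2), −1}}) df_ε(t) ≤ C(T). Then the weak formulation of the ε-fusion problem holds for every test function φ ∈ C¹([0,T]; C¹((0,∞)²)) such that sup_{t∈[0,T], η∈(0,∞)²} ( |∂_t φ(η,t)| + |φ(η,t)| + |∂_a φ(η,t)| ) ≤ C < ∞, not only for compactly supported test functions. -/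

import Mathlib

open MeasureTheory Real Set Filter Topology
open scoped ENNReal

noncomputable section

/-- `c₀ = (36π)^(1/3)`, the isoperimetric constant relating area and volume of a ball. -/
def c0 : ℝ := (36 * Real.pi) ^ ((1 : ℝ) / 3)

/-- The open quadrant `(0,∞)²` of pairs `(a,v)` (surface area, volume). -/
def Quad : Set (ℝ × ℝ) := {p | 0 < p.1 ∧ 0 < p.2}

/-- The isoperimetric region `{(a,v) : v > 0, a ≥ c₀ v^(2/3)}`. -/
def IsoRegion : Set (ℝ × ℝ) := {p | 0 < p.2 ∧ c0 * p.2 ^ ((2 : ℝ) / 3) ≤ p.1}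

/-- A nonnegative (Radon) measure on `(0,∞)²` supported in `{a ≥ c₀ v^(2/3)}`:
it gives zero mass to the complement of the isoperimetric region. -/
def IsIsoMeasure (m : Measure (ℝ × ℝ)) : Prop := m IsoRegionᶜ = 0

/-- `C₀((0,∞)²)`: continuous functions vanishing at infinity of the open quadrant
(extended by zero outside the quadrant). -/
def IsC0Quad (φ : ℝ × ℝ → ℝ) : Prop :=
  Continuous φ ∧ (∀ p, p ∉ Quad → φ p = 0) ∧
    ∀ δ > 0, ∃ Kc : Set (ℝ × ℝ), IsCompact Kc ∧ Kc ⊆ Quad ∧ ∀ p ∉ Kc, |φ p| ≤ δ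

/-- `C_c((0,∞)²)`: continuous functions with compact support contained in the quadrant. -/
def IsCcQuad (φ : ℝ × ℝ → ℝ) : Prop :=
  Continuous φ ∧ HasCompactSupport φ ∧ tsupport φ ⊆ Quad

/-- `C₀((0,∞))`: continuous functions on `(0,∞)` vanishing at infinity (extended by zero). -/
def IsC0Pos (φ : ℝ → ℝ) : Prop :=
  Continuous φ ∧ (∀ v, v ∉ Ioi (0 : ℝ) → φ v = 0) ∧
    ∀ δ > 0, ∃ Kc : Set ℝ, IsCompact Kc ∧ Kc ⊆ Ioi (0 : ℝ) ∧ ∀ v ∉ Kc, |φ v| ≤ δ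

/-- `C_c((0,∞))`: continuous functions with compact support contained in `(0,∞)`. -/
def IsCcPos (φ : ℝ → ℝ) : Prop :=
  Continuous φ ∧ HasCompactSupport φ ∧ tsupport φ ⊆ Ioi (0 : ℝ)

/-- Partial derivative in the area variable `a`. -/
def da (φ : ℝ × ℝ → ℝ) (p : ℝ × ℝ) : ℝ := deriv (fun a => φ (a, p.2)) p.1

/-- Time-dependent test functions `φ ∈ C¹_c([0,∞); C¹_c((0,∞)²))`. -/
def IsTestFun (ψ : ℝ × (ℝ × ℝ) → ℝ) : Prop :=
  ContDiff ℝ 1 ψ ∧ HasCompactSupport ψ ∧ ∀ q : ℝ × (ℝ × ℝ), q.2 ∉ Quad → ψ q = 0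

/-- The assumptions on the coagulation kernel `K`: continuity, symmetry, and the
two-sided power law bounds with constants `K₀ ≥ K₁ > 0` and exponents
`al > 0`, `be ∈ (0,1)`, `be - al ∈ (0,1)`. -/
structure IsCoagKernel (K : ℝ × ℝ → ℝ × ℝ → ℝ) (K₀ K₁ al be : ℝ) : Prop where
  cont : ContinuousOn (fun q : (ℝ × ℝ) × (ℝ × ℝ) => K q.1 q.2) (Quad ×ˢ Quad)
  symm : ∀ η η', K η η' = K η' η
  K1_pos : 0 < K₁
  K1_le_K0 : K₁ ≤ K₀
  al_pos : 0 < al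
  be_mem : be ∈ Ioo (0 : ℝ) 1
  be_sub_al_mem : be - al ∈ Ioo (0 : ℝ) 1
  lower : ∀ η ∈ Quad, ∀ η' ∈ Quad,
    K₁ * (η.2 ^ (-al) * η'.2 ^ be + η'.2 ^ (-al) * η.2 ^ be) ≤ K η η'
  upper : ∀ η ∈ Quad, ∀ η' ∈ Quad,
    K η η' ≤ K₀ * (η.2 ^ (-al) * η'.2 ^ be + η'.2 ^ (-al) * η.2 ^ be)

/-- The assumptions on an admissible fusion kernel `r`: positivity, `C¹` regularity,
two-sided power law bounds `R₀ a^mu v^sg ≤ r ≤ R₁ a^mu v^sg`, and the structural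
differential inequalities on the isoperimetric region. -/
structure IsFusionKernel (r : ℝ × ℝ → ℝ) (R₀ R₁ mu sg B : ℝ) : Prop where
  smooth : ContDiffOn ℝ 1 r Quad
  pos : ∀ η ∈ Quad, 0 < r η
  R0_pos : 0 < R₀
  R1_pos : 0 < R₁
  B_pos : 0 < B
  lower : ∀ η ∈ Quad, R₀ * η.1 ^ mu * η.2 ^ sg ≤ r η
  upper : ∀ η ∈ Quad, r η ≤ R₁ * η.1 ^ mu * η.2 ^ sg
  cond_pos : 0 < mu → ∀ η ∈ IsoRegion, 0 ≤ da r η - mu * η.1⁻¹ * r η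
  cond_nonpos : mu ≤ 0 → ∀ η ∈ IsoRegion,
    0 ≤ da r η * (η.1 - c0 * η.2 ^ ((2 : ℝ) / 3)) + r η
  cond_upper : ∀ η ∈ IsoRegion, da r η ≤ B * η.1⁻¹ * r η

/-- The weak identity at time `t` against the test function `ψ`, for the
fusion–coagulation equation with fusion coefficient `c` (the `Λ`-fusion problem
corresponds to `c = Λ⁻¹`). -/
def WeakIdentity (K : ℝ × ℝ → ℝ × ℝ → ℝ) (r : ℝ × ℝ → ℝ) (c : ℝ)
    (fin : Measure (ℝ × ℝ)) (f : ℝ → Measure (ℝ × ℝ))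
    (ψ : ℝ × (ℝ × ℝ) → ℝ) (t : ℝ) : Prop :=
  (∫ η, ψ (t, η) ∂(f t)) - (∫ η, ψ (0, η) ∂fin)
      - ∫ s in (0 : ℝ)..t, ∫ η, deriv (fun u => ψ (u, η)) s ∂(f s)
    = (∫ s in (0 : ℝ)..t, (1 / 2) *
        ∫ η, ∫ η', K η η' * (ψ (s, η + η') - ψ (s, η) - ψ (s, η')) ∂(f s) ∂(f s))
      + c * ∫ s in (0 : ℝ)..t,
          ∫ η, r η * (c0 * η.2 ^ ((2 : ℝ) / 3) - η.1) * da (fun p => ψ (s, p)) η ∂(f s)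

/-- A weak solution of the fusion–coagulation problem with fusion coefficient `c`
(power-law exponents `al`, `be` of the coagulation kernel enter the a priori moment
bound), initial datum `fin`: a weak-* continuous family of measures supported in the
isoperimetric region, with locally uniformly bounded `(v^(-al) + v^be)`-moments,
satisfying the weak identity for all test functions and times. -/
def IsWeakSolution (K : ℝ × ℝ → ℝ × ℝ → ℝ) (r : ℝ × ℝ → ℝ) (c al be : ℝ)
    (fin : Measure (ℝ × ℝ)) (f : ℝ → Measure (ℝ × ℝ)) : Prop :=
  (∀ t, 0 ≤ t → IsIsoMeasure (f t)) ∧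
  (∀ φ, IsC0Quad φ → ContinuousOn (fun t => ∫ η, φ η ∂(f t)) (Ici (0 : ℝ))) ∧
  (∀ T > (0 : ℝ), ∃ C : ℝ≥0∞, C ≠ ⊤ ∧ ∀ t ∈ Icc (0 : ℝ) T,
      (∫⁻ η, ENNReal.ofReal (η.2 ^ (-al) + η.2 ^ be) ∂(f t)) ≤ C) ∧
  (∀ ψ, IsTestFun ψ → ∀ t, 0 ≤ t → WeakIdentity K r c fin f ψ t)

/-- The regularized fusion kernel `r̄_ε(a,v) = r(a,v)/(1 + ε^(2μ+2) a^μ)`. -/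
def rbarFn (r : ℝ × ℝ → ℝ) (mu ε : ℝ) (η : ℝ × ℝ) : ℝ :=
  r η / (1 + ε ^ (2 * mu + 2) * η.1 ^ mu)

end

/-- A smooth cutoff on the half line: it vanishes outside `[1/N, 2N]` and equals one on
`[2/N, N]`. -/
noncomputable def halfLineCutoff (N x : ℝ) : ℝ :=
  Real.smoothTransition (N * x - 1) * (1 - Real.smoothTransition (x / N - 1))

/-- The product cutoff on the quadrant. -/
noncomputable def quadCutoff (N : ℝ) (η : ℝ × ℝ) : ℝ :=
  halfLineCutoff N η.1 * halfLineCutoff N η.2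

/-- A compact box in the quadrant containing the support of `quadCutoff N`. -/
def quadBox (N : ℝ) : Set (ℝ × ℝ) := Icc N⁻¹ (2 * N) ×ˢ Icc N⁻¹ (2 * N)

theorem halfLineCutoff_nonneg (N x : ℝ) : 0 ≤ halfLineCutoff N x :=
  mul_nonneg (Real.smoothTransition.nonneg _)
    (sub_nonneg.2 (Real.smoothTransition.le_one _))

theorem halfLineCutoff_le_one (N x : ℝ) : halfLineCutoff N x ≤ 1 :=
  mul_le_one₀ (Real.smoothTransition.le_one _)
    (sub_nonneg.2 (Real.smoothTransition.le_one _))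
    (sub_le_self _ (Real.smoothTransition.nonneg _))

theorem contDiff_halfLineCutoff (N : ℝ) : ContDiff ℝ 1 (halfLineCutoff N) := by
  have h : ContDiff ℝ 1 Real.smoothTransition := Real.smoothTransition.contDiff (n := 1)
  exact (h.comp (by fun_prop)).mul (contDiff_const.sub (h.comp (by fun_prop)))

theorem halfLineCutoff_eq_zero {N x : ℝ} (hN : 0 < N) (hx : x ∉ Icc N⁻¹ (2 * N)) :
    halfLineCutoff N x = 0 := by
  unfold halfLineCutoff
  rw [mem_Icc, not_and_or, not_le, not_le] at hx
  rcases hx with hx | hx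
  · have : N * x ≤ 1 := by
      have := mul_lt_mul_of_pos_left hx hN
      rw [mul_inv_cancel₀ hN.ne'] at this
      exact this.le
    rw [Real.smoothTransition.zero_of_nonpos (by linarith), zero_mul]
  · have : 2 ≤ x / N := by rw [le_div_iff₀ hN]; linarith
    rw [Real.smoothTransition.one_of_one_le (x := x / N - 1) (by linarith), sub_self, mul_zero]

theorem halfLineCutoff_eq_one {N x : ℝ} (hN : 0 < N) (h₁ : 2 ≤ N * x) (h₂ : x ≤ N) :
    halfLineCutoff N x = 1 := by
  unfold halfLineCutoff
  have : x / N ≤ 1 := by rwa [div_le_one hN]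
  rw [Real.smoothTransition.one_of_one_le (x := N * x - 1) (by linarith),
    Real.smoothTransition.zero_of_nonpos (by linarith)]
  norm_num

theorem eventually_halfLineCutoff_eventuallyEq_one {x : ℝ} (hx : 0 < x) :
    ∀ᶠ n : ℕ in atTop, halfLineCutoff ((n : ℝ) + 2) =ᶠ[𝓝 x] fun _ => 1 := by
  have hN : Tendsto (fun n : ℕ => (n : ℝ) + 2) atTop atTop :=
    tendsto_atTop_add_const_right _ _ tendsto_natCast_atTop_atTop
  filter_upwards [hN.eventually_gt_atTop x, hN.eventually_gt_atTop (2 / x)] with n h₁ h₂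
  have h₂' : 2 < ((n : ℝ) + 2) * x := by rwa [div_lt_iff₀ hx] at h₂
  have hc : ContinuousAt (fun y : ℝ => ((n : ℝ) + 2) * y) x := by fun_prop
  filter_upwards [hc.eventually (lt_mem_nhds h₂'), gt_mem_nhds h₁] with y hy₁ hy₂
  exact halfLineCutoff_eq_one (by positivity) hy₁.le hy₂.le

theorem exists_abs_mul_deriv_smoothTransition_le :
    ∃ C : ℝ, 0 ≤ C ∧ ∀ y : ℝ, |(y + 1) * deriv Real.smoothTransition y| ≤ C := by
  have h : ContDiff ℝ 1 Real.smoothTransition := Real.smoothTransition.contDiff (n := 1)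
  have hcont : Continuous fun y : ℝ => (y + 1) * deriv Real.smoothTransition y :=
    (by fun_prop : Continuous fun y : ℝ => y + 1).mul (h.continuous_deriv le_rfl)
  have hsupp : HasCompactSupport fun y : ℝ => (y + 1) * deriv Real.smoothTransition y := by
    refine HasCompactSupport.intro (isCompact_Icc (a := (0 : ℝ)) (b := 1)) fun y hy => ?_
    rw [mem_Icc, not_and_or, not_le, not_le] at hy
    rcases hy with hy | hy
    · have : Real.smoothTransition =ᶠ[𝓝 y] fun _ => 0 := by
        filter_upwards [gt_mem_nhds hy] with z hz
        exact Real.smoothTransition.zero_of_nonpos (le_of_lt hz)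
      rw [this.deriv_eq]; simp
    · have : Real.smoothTransition =ᶠ[𝓝 y] fun _ => 1 := by
        filter_upwards [lt_mem_nhds hy] with z hz
        exact Real.smoothTransition.one_of_one_le (le_of_lt hz)
      rw [this.deriv_eq]; simp
  obtain ⟨C, hC⟩ := hcont.bounded_above_of_compact_support hsupp
  exact ⟨C, (norm_nonneg _).trans (hC 0), hC⟩

theorem exists_abs_mul_deriv_halfLineCutoff_le :
    ∃ C : ℝ, 0 ≤ C ∧ ∀ N x : ℝ, 0 < N → |x * deriv (halfLineCutoff N) x| ≤ C := by
  obtain ⟨C, hC, hb⟩ := exists_abs_mul_deriv_smoothTransition_le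
  refine ⟨C + C, by positivity, fun N x hN => ?_⟩
  have hd : Differentiable ℝ Real.smoothTransition :=
    (Real.smoothTransition.contDiff (n := 1)).differentiable (by norm_num)
  have h₁ : HasDerivAt (fun y => Real.smoothTransition (N * y - 1))
      (deriv Real.smoothTransition (N * x - 1) * N) x := by
    refine (hd _).hasDerivAt.comp x ?_
    simpa using ((hasDerivAt_id x).const_mul N).sub_const 1
  have h₂ : HasDerivAt (fun y => 1 - Real.smoothTransition (y / N - 1))
      (-(deriv Real.smoothTransition (x / N - 1) * (1 / N))) x := by
    refine HasDerivAt.const_sub 1 ((hd _).hasDerivAt.comp x ?_)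
    simpa using ((hasDerivAt_id x).div_const N).sub_const 1
  have h₃ : deriv (halfLineCutoff N) x = _ := (h₁.mul h₂).deriv
  have h₄ : x * deriv (halfLineCutoff N) x =
      (((N * x - 1) + 1) * deriv Real.smoothTransition (N * x - 1)) *
          (1 - Real.smoothTransition (x / N - 1)) -
        Real.smoothTransition (N * x - 1) *
          (((x / N - 1) + 1) * deriv Real.smoothTransition (x / N - 1)) := by
    rw [h₃]; field_simp; ring
  rw [h₄]
  refine (abs_sub _ _).trans (add_le_add ?_ ?_)
  · rw [abs_mul, abs_of_nonneg (sub_nonneg.2 (Real.smoothTransition.le_one _))]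
    exact (mul_le_of_le_one_right (abs_nonneg _)
      (sub_le_self _ (Real.smoothTransition.nonneg _))).trans (hb _)
  · rw [abs_mul, abs_of_nonneg (Real.smoothTransition.nonneg _)]
    exact (mul_le_of_le_one_left (abs_nonneg _) (Real.smoothTransition.le_one _)).trans (hb _)

theorem isOpen_Quad : IsOpen Quad :=
  (isOpen_lt continuous_const continuous_fst).inter (isOpen_lt continuous_const continuous_snd)

theorem c0_pos : 0 < c0 := by unfold c0; positivity

theorem IsoRegion_subset_Quad : IsoRegion ⊆ Quad := fun _ hp =>
  ⟨(mul_pos c0_pos (Real.rpow_pos_of_pos hp.1 _)).trans_le hp.2, hp.1⟩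

theorem measurableSet_IsoRegion : MeasurableSet IsoRegion :=
  (measurableSet_lt measurable_const measurable_snd).inter
    (measurableSet_le ((measurable_snd.pow_const _).const_mul _) measurable_fst)

theorem isCompact_quadBox (N : ℝ) : IsCompact (quadBox N) := isCompact_Icc.prod isCompact_Icc

theorem quadBox_subset_Quad {N : ℝ} (hN : 0 < N) : quadBox N ⊆ Quad := fun _ hp =>
  ⟨(inv_pos.2 hN).trans_le hp.1.1, (inv_pos.2 hN).trans_le hp.2.1⟩

theorem quadCutoff_nonneg (N : ℝ) (η : ℝ × ℝ) : 0 ≤ quadCutoff N η :=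
  mul_nonneg (halfLineCutoff_nonneg _ _) (halfLineCutoff_nonneg _ _)

theorem quadCutoff_le_one (N : ℝ) (η : ℝ × ℝ) : quadCutoff N η ≤ 1 :=
  mul_le_one₀ (halfLineCutoff_le_one _ _) (halfLineCutoff_nonneg _ _) (halfLineCutoff_le_one _ _)

theorem contDiff_quadCutoff (N : ℝ) : ContDiff ℝ 1 (quadCutoff N) :=
  ((contDiff_halfLineCutoff N).comp contDiff_fst).mul
    ((contDiff_halfLineCutoff N).comp contDiff_snd)

theorem quadCutoff_eq_zero {N : ℝ} (hN : 0 < N) {η : ℝ × ℝ} (hη : η ∉ quadBox N) :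
    quadCutoff N η = 0 := by
  rw [quadBox, mem_prod, not_and_or] at hη
  rcases hη with h | h
  · rw [quadCutoff, halfLineCutoff_eq_zero hN h, zero_mul]
  · rw [quadCutoff, halfLineCutoff_eq_zero hN h, mul_zero]

theorem eventually_quadCutoff_eq_one {η : ℝ × ℝ} (hη : η ∈ Quad) :
    ∀ᶠ n : ℕ in atTop, quadCutoff ((n : ℝ) + 2) η = 1 := by
  filter_upwards [eventually_halfLineCutoff_eventuallyEq_one hη.1,
    eventually_halfLineCutoff_eventuallyEq_one hη.2] with n h₁ h₂
  rw [quadCutoff, h₁.eq_of_nhds, h₂.eq_of_nhds, one_mul]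

theorem tendsto_quadCutoff {η : ℝ × ℝ} (hη : η ∈ Quad) :
    Tendsto (fun n : ℕ => quadCutoff ((n : ℝ) + 2) η) atTop (𝓝 1) :=
  tendsto_nhds_of_eventually_eq (eventually_quadCutoff_eq_one hη)

/-- A localized function which is `C¹` in the relevant region is a test function. -/
theorem isTestFun_cutoff {N : ℝ} (hN : 0 < N) {c : ℝ} (b : ContDiffBump c) {U : Set ℝ}
    (hU : IsOpen U) (hb : Metric.closedBall c b.rOut ⊆ U) {Φ : ℝ × (ℝ × ℝ) → ℝ}
    (hΦ : ContDiffOn ℝ 1 Φ (U ×ˢ Quad)) :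
    IsTestFun fun q => b q.1 * (quadCutoff N q.2 * Φ q) := by
  set C : Set (ℝ × (ℝ × ℝ)) := Metric.closedBall c b.rOut ×ˢ quadBox N with hCdef
  have hC : IsCompact C := (isCompact_closedBall _ _).prod (isCompact_quadBox N)
  have hzero : ∀ q ∉ C, b q.1 * (quadCutoff N q.2 * Φ q) = 0 := by
    intro q hq
    rw [hCdef, mem_prod, not_and_or] at hq
    rcases hq with h | h
    · rw [b.zero_of_le_dist (le_of_lt (by simpa using h)), zero_mul]
    · rw [quadCutoff_eq_zero hN h, zero_mul, mul_zero]
  refine ⟨contDiff_iff_contDiffAt.2 fun q => ?_, HasCompactSupport.intro hC hzero, ?_⟩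
  · by_cases hq : q ∈ C
    · have hmem : U ×ˢ Quad ∈ 𝓝 q :=
        (hU.prod isOpen_Quad).mem_nhds ⟨hb hq.1, quadBox_subset_Quad hN hq.2⟩
      exact (b.contDiff.comp contDiff_fst).contDiffAt.mul
        (((contDiff_quadCutoff N).comp contDiff_snd).contDiffAt.mul (hΦ.contDiffAt hmem))
    · refine (contDiffAt_const (c := (0 : ℝ))).congr_of_eventuallyEq ?_
      filter_upwards [hC.isClosed.isOpen_compl.mem_nhds hq] with p hp using hzero p hp
  · intro q hq
    beta_reduce
    rw [quadCutoff_eq_zero hN fun h => hq (quadBox_subset_Quad hN h), zero_mul, mul_zero]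

theorem measurable_indicator_of_continuousOn {X : Type*} [TopologicalSpace X] [MeasurableSpace X]
    [OpensMeasurableSpace X] {g : X → ℝ} {S : Set X} (hg : ContinuousOn g S)
    (hS : MeasurableSet S) : Measurable (S.indicator g) := by
  classical
  have := hg.measurable_piecewise (continuousOn_const (c := (0 : ℝ))) hS
  rwa [← piecewise_eq_indicator]

/-- The truncation to `[0,T]` of a family of finite measures which is weakly continuous against
`C₀((0,∞)²)` is a measurable family. -/
theorem measurable_truncated_measure {T : ℝ} {f : ℝ → Measure (ℝ × ℝ)}
    (hfin : ∀ s ∈ Icc (0 : ℝ) T, IsFiniteMeasure (f s))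
    (hiso : ∀ s, 0 ≤ s → IsIsoMeasure (f s))
    (hcont : ∀ φ, IsC0Quad φ → ContinuousOn (fun t => ∫ η, φ η ∂(f t)) (Ici (0 : ℝ))) :
    Measurable ((Icc (0 : ℝ) T).indicator f) := by
  have hfin' : ∀ s, IsFiniteMeasure ((Icc (0 : ℝ) T).indicator f s) := by
    intro s
    by_cases hs : s ∈ Icc (0 : ℝ) T
    · rw [indicator_of_mem hs]; exact hfin s hs
    · rw [indicator_of_notMem hs]; infer_instance
  have hclosed : ∀ F : Set (ℝ × ℝ), IsClosed F →
      Measurable fun s => (Icc (0 : ℝ) T).indicator f s F := by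
    intro F hF
    have hpos : ∀ n : ℕ, 0 < 1 / ((n : ℝ) + 1) := fun n => by positivity
    set g : ℕ → ℝ × ℝ → ℝ := fun n η =>
      quadCutoff ((n : ℝ) + 2) η * (thickenedIndicator (hpos n) F η : ℝ) with hg
    have hgc : ∀ n, Continuous (g n) := fun n =>
      (contDiff_quadCutoff _).continuous.mul
        (NNReal.continuous_coe.comp (thickenedIndicator (hpos n) F).continuous)
    have hgz : ∀ n : ℕ, ∀ η ∉ quadBox ((n : ℝ) + 2), g n η = 0 := fun n η hη => by
      rw [hg]; beta_reduce; rw [quadCutoff_eq_zero (by positivity) hη, zero_mul]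
    have hgb : ∀ n η, ‖g n η‖ ≤ 1 := fun n η => by
      rw [norm_mul, Real.norm_of_nonneg (quadCutoff_nonneg _ _), Real.norm_of_nonneg (by positivity)]
      exact mul_le_one₀ (quadCutoff_le_one _ _) (by positivity)
        (by exact_mod_cast thickenedIndicator_le_one (hpos n) F η)
    have hC0 : ∀ n, IsC0Quad (g n) := fun n =>
      ⟨hgc n, fun p hp => hgz n p fun h => hp (quadBox_subset_Quad (by positivity) h),
        fun δ hδ => ⟨quadBox ((n : ℝ) + 2), isCompact_quadBox _,
          quadBox_subset_Quad (by positivity), fun p hp => by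
            rw [hgz n p hp, abs_zero]; exact hδ.le⟩⟩
    have hmeas : ∀ n, Measurable ((Icc (0 : ℝ) T).indicator fun s => ∫ η, g n η ∂(f s)) :=
      fun n => measurable_indicator_of_continuousOn
        ((hcont _ (hC0 n)).mono fun s hs => hs.1) measurableSet_Icc
    have hlim : ∀ s, Tendsto (fun n => (Icc (0 : ℝ) T).indicator (fun s => ∫ η, g n η ∂(f s)) s)
        atTop (𝓝 (((Icc (0 : ℝ) T).indicator f s).real F)) := by
      intro s
      by_cases hs : s ∈ Icc (0 : ℝ) T
      · simp only [indicator_of_mem hs]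
        have := hfin s hs
        have hF' : (f s).real F = ∫ η, F.indicator (fun _ => (1 : ℝ)) η ∂(f s) := by
          rw [integral_indicator_const _ hF.measurableSet, smul_eq_mul, mul_one]
        rw [hF']
        refine tendsto_integral_of_dominated_convergence (fun _ => 1)
          (fun n => (hgc n).aestronglyMeasurable) (integrable_const _)
          (fun n => ae_of_all _ (hgb n)) ?_
        have hae : ∀ᵐ η ∂(f s), η ∈ IsoRegion := hiso s hs.1
        filter_upwards [hae] with η hη
        have h₁ := tendsto_quadCutoff (IsoRegion_subset_Quad hη)
        have h₂ := thickenedIndicator_tendsto_indicator_closure hpos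
          tendsto_one_div_add_atTop_nhds_zero_nat F
        rw [hF.closure_eq, tendsto_pi_nhds] at h₂
        have h₃ := (NNReal.continuous_coe.tendsto _).comp (h₂ η)
        have h₄ := h₁.mul h₃
        rw [one_mul] at h₄
        have h₅ : ((F.indicator (fun _ => (1 : NNReal)) η : NNReal) : ℝ) =
            F.indicator (fun _ => (1 : ℝ)) η := by
          by_cases h : η ∈ F <;> simp [h]
        rwa [h₅] at h₄
      · simp only [indicator_of_notMem hs]
        simp
    have hreal := measurable_of_tendsto_metrizable hmeas (tendsto_pi_nhds.2 hlim)
    have heq : (fun s => (Icc (0 : ℝ) T).indicator f s F) =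
        fun s => ENNReal.ofReal (((Icc (0 : ℝ) T).indicator f s).real F) := by
      funext s
      have := hfin' s
      rw [ofReal_measureReal]
    rw [heq]
    exact hreal.ennreal_ofReal
  refine Measurable.measure_of_isPiSystem (S := {s | IsClosed s}) ?_ isPiSystem_isClosed
    (fun F hF => hclosed F hF) (hclosed univ isClosed_univ)
  rw [BorelSpace.measurable_eq (α := ℝ × ℝ), borel_eq_generateFrom_isClosed]

/-- Dominated convergence for time integrals of spatial integrals against a kernel. -/
theorem tendsto_intervalIntegral_integral_kernel {X : Type*} [TopologicalSpace X]
    [SecondCountableTopology X] [MeasurableSpace X] [BorelSpace X]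
    (κ : ProbabilityTheory.Kernel ℝ X) [ProbabilityTheory.IsSFiniteKernel κ]
    {S : Set X} (hS : MeasurableSet S) {T t : ℝ} (ht : t ∈ Icc 0 T)
    (hκS : ∀ s ∈ Ioo 0 T, ∀ᵐ x ∂(κ s), x ∈ S)
    {G : ℕ → ℝ → X → ℝ} {G' : ℝ → X → ℝ} {F : ℕ → ℝ → ℝ} {F' : ℝ → ℝ} {w : X → ℝ} {M : ℝ}
    (hG : ∀ n, ContinuousOn (fun q : ℝ × X => G n q.1 q.2) (Ioo 0 T ×ˢ S))
    (hw : ∀ s ∈ Ioo 0 T, Integrable w (κ s)) (hwM : ∀ s ∈ Ioo 0 T, ∫ x, w x ∂(κ s) ≤ M)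
    (hbound : ∀ n, ∀ s ∈ Ioo 0 T, ∀ x ∈ S, |G n s x| ≤ w x)
    (hlim : ∀ s ∈ Ioo 0 T, ∀ x ∈ S, Tendsto (fun n => G n s x) atTop (𝓝 (G' s x)))
    (hF : ∀ n, ∀ s ∈ Ioo 0 T, (Integrable (G n s) (κ s) → F n s = ∫ x, G n s x ∂(κ s)))
    (hF' : ∀ s ∈ Ioo 0 T, (Integrable (G' s) (κ s) → F' s = ∫ x, G' s x ∂(κ s))) :
    Tendsto (fun n => ∫ s in (0 : ℝ)..t, F n s) atTop (𝓝 (∫ s in (0 : ℝ)..t, F' s)) := by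
  have hIoo : Ioo 0 t ⊆ Ioo 0 T := Ioo_subset_Ioo_right ht.2
  set H : ℕ → ℝ × X → ℝ := fun n => (Ioo 0 T ×ˢ S).indicator fun q => G n q.1 q.2 with hH
  have hHm : ∀ n, Measurable (H n) :=
    fun n => measurable_indicator_of_continuousOn (hG n) (measurableSet_Ioo.prod hS)
  have hHG : ∀ n, ∀ s ∈ Ioo 0 T, G n s =ᵐ[κ s] fun x => H n (s, x) := by
    intro n s hs
    filter_upwards [hκS s hs] with x hx
    rw [hH]; beta_reduce
    rw [indicator_of_mem (mk_mem_prod hs hx)]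
  have hGm : ∀ n, ∀ s ∈ Ioo 0 T, AEStronglyMeasurable (G n s) (κ s) := fun n s hs =>
    ((hHm n).comp measurable_prodMk_left).aestronglyMeasurable.congr (hHG n s hs).symm
  have hGb : ∀ n, ∀ s ∈ Ioo 0 T, ∀ᵐ x ∂(κ s), ‖G n s x‖ ≤ w x := by
    intro n s hs
    filter_upwards [hκS s hs] with x hx using hbound n s hs x hx
  have hGi : ∀ n, ∀ s ∈ Ioo 0 T, Integrable (G n s) (κ s) := fun n s hs =>
    (hw s hs).mono' (hGm n s hs) (hGb n s hs)
  have hGl : ∀ s ∈ Ioo 0 T, ∀ᵐ x ∂(κ s), Tendsto (fun n => G n s x) atTop (𝓝 (G' s x)) := by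
    intro s hs
    filter_upwards [hκS s hs] with x hx using hlim s hs x hx
  have hGi' : ∀ s ∈ Ioo 0 T, Integrable (G' s) (κ s) := by
    intro s hs
    refine (hw s hs).mono' (aestronglyMeasurable_of_tendsto_ae atTop
      (fun n => hGm n s hs) (hGl s hs)) ?_
    filter_upwards [hκS s hs] with x hx
    exact le_of_tendsto (hlim s hs x hx).norm (Eventually.of_forall fun n => hbound n s hs x hx)
  simp only [intervalIntegral.integral_of_le ht.1, integral_Ioc_eq_integral_Ioo]
  refine tendsto_integral_of_dominated_convergence (fun _ => M) (fun n => ?_) (integrable_const _)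
    (fun n => ?_) ?_
  · have h : StronglyMeasurable fun s => ∫ x, H n (s, x) ∂(κ s) :=
      (hHm n).stronglyMeasurable.integral_kernel_prod_right'
    refine h.aestronglyMeasurable.congr ?_
    filter_upwards [ae_restrict_mem measurableSet_Ioo] with s hs
    rw [hF n s (hIoo hs) (hGi n s (hIoo hs)), integral_congr_ae (hHG n s (hIoo hs))]
  · filter_upwards [ae_restrict_mem measurableSet_Ioo] with s hs
    rw [hF n s (hIoo hs) (hGi n s (hIoo hs))]
    exact (norm_integral_le_of_norm_le (hw s (hIoo hs)) (hGb n s (hIoo hs))).trans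
      (hwM s (hIoo hs))
  · filter_upwards [ae_restrict_mem measurableSet_Ioo] with s hs
    rw [hF' s (hIoo hs) (hGi' s (hIoo hs))]
    simp only [fun n => hF n s (hIoo hs) (hGi n s (hIoo hs))]
    exact tendsto_integral_of_dominated_convergence w (fun n => hGm n s (hIoo hs))
      (hw s (hIoo hs)) (fun n => hGb n s (hIoo hs)) (hGl s (hIoo hs))

/-- A nonnegative function with finite `lintegral` is integrable, with the expected bound. -/
theorem integrable_and_integral_le_of_lintegral_le {X : Type*} [MeasurableSpace X]
    {m : Measure X} {w : X → ℝ} (hwm : Measurable w) (hw : ∀ᵐ x ∂m, 0 ≤ w x) {C : ℝ≥0∞}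
    (hC : C ≠ ⊤) (h : ∫⁻ x, ENNReal.ofReal (w x) ∂m ≤ C) :
    Integrable w m ∧ ∫ x, w x ∂m ≤ C.toReal := by
  refine ⟨⟨hwm.aestronglyMeasurable, ?_⟩, ?_⟩
  · rw [hasFiniteIntegral_iff_ofReal hw]
    exact h.trans_lt hC.lt_top
  · rw [integral_eq_lintegral_of_nonneg_ae hw hwm.aestronglyMeasurable]
    exact ENNReal.toReal_mono hC h

/-- On the quadrant the moment weight is at least one, so high moments control the total mass. -/
theorem one_le_moment_weight {p q b a v : ℝ} (ha : 0 < a) (hv : 0 < v) (hp : 0 ≤ p) (hq : q ≤ 0) :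
    1 ≤ a ^ b + v ^ p + v ^ q := by
  have h₀ := Real.rpow_nonneg ha.le b
  have h₁ := Real.rpow_nonneg hv.le p
  have h₂ := Real.rpow_nonneg hv.le q
  rcases le_total 1 v with h | h
  · linarith [Real.one_le_rpow h hp]
  · linarith [Real.one_le_rpow_of_pos_of_le_one_of_nonpos hv h hq]

theorem rpow_le_rpow_add_rpow {v p q s : ℝ} (hv : 0 < v) (hq : q ≤ s) (hp : s ≤ p) :
    v ^ s ≤ v ^ p + v ^ q := by
  have h₁ := Real.rpow_nonneg hv.le p
  have h₂ := Real.rpow_nonneg hv.le q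
  rcases le_total 1 v with h | h
  · linarith [Real.rpow_le_rpow_of_exponent_le h hp]
  · linarith [Real.rpow_le_rpow_of_exponent_ge hv h hq]

/-- The high moments control the fusion rate. -/
theorem fusion_weight_le {mu sg a v : ℝ} (hmu : 0 < mu) (ha : 0 < a) (hv : 0 < v) :
    a ^ mu * v ^ sg * (a + 1) ≤ 3 * (a ^ (mu + 2) + v ^ (max (sg * (mu + 2)) 2)
      + v ^ (min (sg * (mu + 2)) (-1))) := by
  set P := max (sg * (mu + 2)) 2
  set Q := min (sg * (mu + 2)) (-1)
  have hA := Real.rpow_nonneg ha.le (mu + 2)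
  have hw : 0 < v ^ sg := Real.rpow_pos_of_pos hv _
  have hsg : v ^ (sg * (mu + 2)) ≤ v ^ P + v ^ Q :=
    rpow_le_rpow_add_rpow hv (min_le_left _ _) (le_max_left _ _)
  have hsg' : v ^ sg ≤ v ^ P + v ^ Q := by
    refine rpow_le_rpow_add_rpow hv ?_ ?_
    · rcases le_total 0 sg with h | h
      · exact (min_le_right _ _).trans (by linarith)
      · exact (min_le_left _ _).trans (by nlinarith)
    · rcases le_total 0 sg with h | h
      · exact le_trans (by nlinarith) (le_max_left _ _)
      · exact le_trans (by linarith) (le_max_right _ _)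
  have h₁ : a ^ mu * v ^ sg * a ≤ a ^ (mu + 2) + v ^ (sg * (mu + 2)) := by
    have e : a ^ mu * v ^ sg * a = a ^ (mu + 1) * v ^ sg := by
      rw [Real.rpow_add_one ha.ne']; ring
    rw [e]
    rcases le_total (v ^ sg) a with h | h
    · have : a ^ (mu + 1) * v ^ sg ≤ a ^ (mu + 1) * a :=
        mul_le_mul_of_nonneg_left h (Real.rpow_nonneg ha.le _)
      rw [← Real.rpow_add_one ha.ne', show mu + 1 + 1 = mu + 2 by ring] at this
      linarith [Real.rpow_nonneg hv.le (sg * (mu + 2))]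
    · have : a ^ (mu + 1) * v ^ sg ≤ (v ^ sg) ^ (mu + 1) * v ^ sg :=
        mul_le_mul_of_nonneg_right (Real.rpow_le_rpow ha.le h (by linarith)) hw.le
      rw [← Real.rpow_add_one hw.ne', show mu + 1 + 1 = mu + 2 by ring, ← Real.rpow_mul hv.le]
        at this
      linarith
  have h₂ : a ^ mu * v ^ sg ≤ a ^ mu * v ^ sg * a + v ^ sg := by
    rcases le_total 1 a with h | h
    · have := mul_le_mul_of_nonneg_left h (mul_nonneg (Real.rpow_nonneg ha.le mu) hw.le)
      linarith
    · have := mul_le_mul_of_nonneg_right (Real.rpow_le_one ha.le h hmu.le) hw.le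
      have h0 : 0 ≤ a ^ mu * v ^ sg * a := by positivity
      linarith
  linarith

theorem hasDerivAt_time {U : Set ℝ} (hU : IsOpen U) {Φ : ℝ × (ℝ × ℝ) → ℝ}
    (hΦ : ContDiffOn ℝ 1 Φ (U ×ˢ Quad)) {s : ℝ} (hs : s ∈ U) {η : ℝ × ℝ} (hη : η ∈ Quad) :
    HasDerivAt (fun u => Φ (u, η)) (fderiv ℝ Φ (s, η) (1, 0)) s := by
  have hd : HasFDerivAt Φ (fderiv ℝ Φ (s, η)) (s, η) :=
    ((hΦ.contDiffAt ((hU.prod isOpen_Quad).mem_nhds (mk_mem_prod hs hη))).differentiableAt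
      (by norm_num)).hasFDerivAt
  exact hd.comp_hasDerivAt s ((hasDerivAt_id s).prodMk (hasDerivAt_const s η))

theorem hasDerivAt_area {U : Set ℝ} (hU : IsOpen U) {Φ : ℝ × (ℝ × ℝ) → ℝ}
    (hΦ : ContDiffOn ℝ 1 Φ (U ×ˢ Quad)) {s : ℝ} (hs : s ∈ U) {η : ℝ × ℝ} (hη : η ∈ Quad) :
    HasDerivAt (fun a => Φ (s, (a, η.2))) (fderiv ℝ Φ (s, η) (0, (1, 0))) η.1 := by
  have hd : HasFDerivAt Φ (fderiv ℝ Φ (s, η)) (s, (η.1, η.2)) :=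
    ((hΦ.contDiffAt ((hU.prod isOpen_Quad).mem_nhds (mk_mem_prod hs hη))).differentiableAt
      (by norm_num)).hasFDerivAt
  exact hd.comp_hasDerivAt η.1 ((hasDerivAt_const η.1 s).prodMk
    ((hasDerivAt_id η.1).prodMk (hasDerivAt_const η.1 η.2)))

theorem continuousOn_deriv_time {U : Set ℝ} (hU : IsOpen U) {Φ : ℝ × (ℝ × ℝ) → ℝ}
    (hΦ : ContDiffOn ℝ 1 Φ (U ×ˢ Quad)) :
    ContinuousOn (fun q : ℝ × (ℝ × ℝ) => deriv (fun u => Φ (u, q.2)) q.1) (U ×ˢ Quad) :=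
  ((hΦ.continuousOn_fderiv_of_isOpen (hU.prod isOpen_Quad) le_rfl).clm_apply
    continuousOn_const).congr fun _ hq => (hasDerivAt_time hU hΦ hq.1 hq.2).deriv

theorem continuousOn_da {U : Set ℝ} (hU : IsOpen U) {Φ : ℝ × (ℝ × ℝ) → ℝ}
    (hΦ : ContDiffOn ℝ 1 Φ (U ×ˢ Quad)) :
    ContinuousOn (fun q : ℝ × (ℝ × ℝ) => da (fun p => Φ (q.1, p)) q.2) (U ×ˢ Quad) :=
  ((hΦ.continuousOn_fderiv_of_isOpen (hU.prod isOpen_Quad) le_rfl).clm_apply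
    continuousOn_const).congr fun _ hq => (hasDerivAt_area hU hΦ hq.1 hq.2).deriv

/-- The contraction of the time axis towards `T/2`, mapping `[0,T]` into `(0,T)`. -/
noncomputable def timeShrink (T N s : ℝ) : ℝ := T / 2 + (1 - N⁻¹) * (s - T / 2)

theorem contDiff_timeShrink (T N : ℝ) : ContDiff ℝ 1 (timeShrink T N) := by
  unfold timeShrink; fun_prop

theorem hasDerivAt_timeShrink (T N s : ℝ) : HasDerivAt (timeShrink T N) (1 - N⁻¹) s := by
  have h := (((hasDerivAt_id s).sub_const (T / 2)).const_mul (1 - N⁻¹)).const_add (T / 2)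
  rw [mul_one] at h
  exact h

theorem timeShrink_mem {T N s : ℝ} (hT : 0 < T) (hN : 2 ≤ N) (hs : s ∈ Icc 0 T) :
    timeShrink T N s ∈ Ioo 0 T := by
  have h₀ : 0 < N⁻¹ := by positivity
  have h₁ : N⁻¹ < 1 := inv_lt_one_of_one_lt₀ (by linarith)
  unfold timeShrink
  constructor <;> nlinarith [hs.1, hs.2]

theorem tendsto_timeShrink (T s : ℝ) :
    Tendsto (fun n : ℕ => timeShrink T ((n : ℝ) + 2) s) atTop (𝓝 s) := by
  have hN : Tendsto (fun n : ℕ => ((n : ℝ) + 2)⁻¹) atTop (𝓝 0) :=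
    (tendsto_atTop_add_const_right _ _ tendsto_natCast_atTop_atTop).inv_tendsto_atTop
  have h : Tendsto (fun n : ℕ => T / 2 + (1 - ((n : ℝ) + 2)⁻¹) * (s - T / 2)) atTop
      (𝓝 (T / 2 + (1 - 0) * (s - T / 2))) := ((hN.const_sub 1).mul_const _).const_add _
  simpa [timeShrink] using h

/-- A bump in time which equals one on `[0,T]` and whose support is mapped into `(0,T)` by
`timeShrink T N`. -/
noncomputable def timeBump {T N : ℝ} (hT : 0 < T) (hN : 2 ≤ N) : ContDiffBump (T / 2) where
  rIn := T / 2
  rOut := T / 2 * (1 + N⁻¹)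
  rIn_pos := by positivity
  rIn_lt_rOut := by
    have : 0 < N⁻¹ := by positivity
    nlinarith

/-- The localized, time-shrunk approximation of a test function. -/
noncomputable def approxTest {T N : ℝ} (hT : 0 < T) (hN : 2 ≤ N) (ψ : ℝ × (ℝ × ℝ) → ℝ)
    (q : ℝ × (ℝ × ℝ)) : ℝ :=
  timeBump hT hN q.1 * (quadCutoff N q.2 * ψ (timeShrink T N q.1, q.2))

section Approx

variable {T N : ℝ} (hT : 0 < T) (hN : 2 ≤ N) {ψ : ℝ × (ℝ × ℝ) → ℝ}

theorem isTestFun_approxTest (hψ : ContDiffOn ℝ 1 ψ (Ioo 0 T ×ˢ Quad)) :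
    IsTestFun (approxTest hT hN ψ) := by
  have hN₀ : 0 < N := by linarith
  have hU : IsOpen (timeShrink T N ⁻¹' Ioo 0 T) :=
    isOpen_Ioo.preimage (contDiff_timeShrink T N).continuous
  refine isTestFun_cutoff hN₀ (timeBump hT hN) hU (fun s hs => ?_) ?_
  · rw [Real.closedBall_eq_Icc] at hs
    have h₁ : s - T / 2 ≤ T / 2 * (1 + N⁻¹) := by
      have := hs.2; change s ≤ T / 2 + T / 2 * (1 + N⁻¹) at this; linarith
    have h₂ : -(T / 2 * (1 + N⁻¹)) ≤ s - T / 2 := by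
      have := hs.1; change T / 2 - T / 2 * (1 + N⁻¹) ≤ s at this; linarith
    have h₃ : 0 < N⁻¹ := by positivity
    have h₄ : 0 ≤ 1 - N⁻¹ := sub_nonneg.2 (inv_le_one_of_one_le₀ (by linarith))
    have h₅ : 0 < T / 2 * (N⁻¹ * N⁻¹) := by positivity
    change timeShrink T N s ∈ Ioo 0 T
    unfold timeShrink
    have h₆ := mul_le_mul_of_nonneg_left h₁ h₄
    have h₇ := mul_le_mul_of_nonneg_left h₂ h₄
    constructor <;> nlinarith
  · exact hψ.comp (((contDiff_timeShrink T N).comp contDiff_fst).prodMk contDiff_snd).contDiffOn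
      fun q hq => ⟨hq.1, hq.2⟩

theorem approxTest_eq {s : ℝ} (hs : s ∈ Icc 0 T) (η : ℝ × ℝ) :
    approxTest hT hN ψ (s, η) = quadCutoff N η * ψ (timeShrink T N s, η) := by
  have : timeBump hT hN s = 1 := by
    refine (timeBump hT hN).one_of_mem_closedBall ?_
    rw [Real.closedBall_eq_Icc]
    change s ∈ Icc (T / 2 - T / 2) (T / 2 + T / 2)
    simpa using hs
  rw [approxTest, this, one_mul]

theorem abs_approxTest_le {C : ℝ} (hC : ∀ s ∈ Icc 0 T, ∀ η ∈ Quad, |ψ (s, η)| ≤ C) {s : ℝ}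
    (hs : s ∈ Icc 0 T) {η : ℝ × ℝ} (hη : η ∈ Quad) : |approxTest hT hN ψ (s, η)| ≤ C := by
  rw [approxTest_eq hT hN hs, abs_mul, abs_of_nonneg (quadCutoff_nonneg _ _)]
  exact (mul_le_of_le_one_left (abs_nonneg _) (quadCutoff_le_one _ _)).trans
    (hC _ (Ioo_subset_Icc_self (timeShrink_mem hT hN hs)) _ hη)

theorem deriv_approxTest (hψ : ContDiffOn ℝ 1 ψ (Ioo 0 T ×ˢ Quad)) {s : ℝ} (hs : s ∈ Ioo 0 T)
    {η : ℝ × ℝ} (hη : η ∈ Quad) :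
    deriv (fun u => approxTest hT hN ψ (u, η)) s =
      quadCutoff N η * (deriv (fun u => ψ (u, η)) (timeShrink T N s) * (1 - N⁻¹)) := by
  have hev : (fun u => approxTest hT hN ψ (u, η)) =ᶠ[𝓝 s]
      fun u => quadCutoff N η * ψ (timeShrink T N u, η) := by
    filter_upwards [Icc_mem_nhds hs.1 hs.2] with u hu using approxTest_eq hT hN hu η
  have hd := hasDerivAt_time isOpen_Ioo hψ
    (timeShrink_mem hT hN (Ioo_subset_Icc_self hs)) hη
  rw [hev.deriv_eq, hd.deriv]
  exact ((hd.comp s (hasDerivAt_timeShrink T N s)).const_mul _).deriv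

theorem da_approxTest (hψ : ContDiffOn ℝ 1 ψ (Ioo 0 T ×ˢ Quad)) {s : ℝ} (hs : s ∈ Icc 0 T)
    {η : ℝ × ℝ} (hη : η ∈ Quad) :
    da (fun p => approxTest hT hN ψ (s, p)) η =
      deriv (halfLineCutoff N) η.1 * halfLineCutoff N η.2 * ψ (timeShrink T N s, η) +
        quadCutoff N η * da (fun p => ψ (timeShrink T N s, p)) η := by
  have hd := hasDerivAt_area isOpen_Ioo hψ (timeShrink_mem hT hN hs) hη
  have hc : HasDerivAt (fun a => halfLineCutoff N a * halfLineCutoff N η.2)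
      (deriv (halfLineCutoff N) η.1 * halfLineCutoff N η.2) η.1 :=
    (((contDiff_halfLineCutoff N).differentiable (by norm_num)) η.1).hasDerivAt.mul_const _
  have hda : da (fun p => ψ (timeShrink T N s, p)) η = _ := hd.deriv
  rw [hda]
  have hfun : (fun a => approxTest hT hN ψ (s, (a, η.2))) =
      fun a => halfLineCutoff N a * halfLineCutoff N η.2 * ψ (timeShrink T N s, (a, η.2)) :=
    funext fun a => approxTest_eq hT hN hs _
  change deriv (fun a => approxTest hT hN ψ (s, (a, η.2))) η.1 = _
  rw [hfun]
  exact (hc.mul hd).deriv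

end Approx

theorem tendsto_approxTest {T : ℝ} (hT : 0 < T) {ψ : ℝ × (ℝ × ℝ) → ℝ}
    (hψ : ContinuousOn ψ (Icc 0 T ×ˢ Quad)) {s : ℝ} (hs : s ∈ Icc 0 T) {η : ℝ × ℝ}
    (hη : η ∈ Quad) (hN : ∀ n : ℕ, (2 : ℝ) ≤ n + 2) :
    Tendsto (fun n : ℕ => approxTest hT (hN n) ψ (s, η)) atTop (𝓝 (ψ (s, η))) := by
  simp only [fun n => approxTest_eq hT (hN n) (ψ := ψ) hs η]
  have h : Tendsto (fun n : ℕ => (timeShrink T ((n : ℝ) + 2) s, η)) atTop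
      (𝓝[Icc 0 T ×ˢ Quad] (s, η)) :=
    tendsto_nhdsWithin_iff.2 ⟨(tendsto_timeShrink T s).prodMk_nhds tendsto_const_nhds,
      Eventually.of_forall fun n =>
        ⟨Ioo_subset_Icc_self (timeShrink_mem hT (hN n) hs), hη⟩⟩
  have := (tendsto_quadCutoff hη).mul (Tendsto.comp (hψ (s, η) ⟨hs, hη⟩) h)
  rwa [one_mul] at this

theorem tendsto_comp_timeShrink {T : ℝ} {Φ : ℝ × (ℝ × ℝ) → ℝ}
    (hΦ : ContinuousOn Φ (Ioo 0 T ×ˢ Quad)) {s : ℝ} (hs : s ∈ Ioo 0 T) {η : ℝ × ℝ}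
    (hη : η ∈ Quad) :
    Tendsto (fun n : ℕ => Φ (timeShrink T ((n : ℝ) + 2) s, η)) atTop (𝓝 (Φ (s, η))) :=
  (hΦ.continuousAt ((isOpen_Ioo.prod isOpen_Quad).mem_nhds ⟨hs, hη⟩)).tendsto.comp
    ((tendsto_timeShrink T s).prodMk_nhds tendsto_const_nhds)

theorem tendsto_deriv_approxTest {T : ℝ} (hT : 0 < T) {ψ : ℝ × (ℝ × ℝ) → ℝ}
    (hψ : ContDiffOn ℝ 1 ψ (Ioo 0 T ×ˢ Quad)) {s : ℝ} (hs : s ∈ Ioo 0 T) {η : ℝ × ℝ}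
    (hη : η ∈ Quad) (hN : ∀ n : ℕ, (2 : ℝ) ≤ n + 2) :
    Tendsto (fun n : ℕ => deriv (fun u => approxTest hT (hN n) ψ (u, η)) s) atTop
      (𝓝 (deriv (fun u => ψ (u, η)) s)) := by
  simp only [fun n => deriv_approxTest hT (hN n) hψ hs hη]
  have hinv : Tendsto (fun n : ℕ => 1 - ((n : ℝ) + 2)⁻¹) atTop (𝓝 (1 - 0)) :=
    (tendsto_atTop_add_const_right _ _ tendsto_natCast_atTop_atTop).inv_tendsto_atTop.const_sub 1
  have := (tendsto_quadCutoff hη).mul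
    ((tendsto_comp_timeShrink (continuousOn_deriv_time isOpen_Ioo hψ) hs hη).mul hinv)
  simpa using this

theorem tendsto_da_approxTest {T : ℝ} (hT : 0 < T) {ψ : ℝ × (ℝ × ℝ) → ℝ}
    (hψ : ContDiffOn ℝ 1 ψ (Ioo 0 T ×ˢ Quad)) {s : ℝ} (hs : s ∈ Ioo 0 T) {η : ℝ × ℝ}
    (hη : η ∈ Quad) (hN : ∀ n : ℕ, (2 : ℝ) ≤ n + 2) :
    Tendsto (fun n : ℕ => da (fun p => approxTest hT (hN n) ψ (s, p)) η) atTop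
      (𝓝 (da (fun p => ψ (s, p)) η)) := by
  have h := (tendsto_quadCutoff hη).mul
    (tendsto_comp_timeShrink (continuousOn_da isOpen_Ioo hψ) hs hη)
  rw [one_mul] at h
  refine h.congr' ?_
  filter_upwards [eventually_halfLineCutoff_eventuallyEq_one hη.1] with n hn
  rw [da_approxTest hT (hN n) hψ (Ioo_subset_Icc_self hs) hη, hn.deriv_eq]
  simp

theorem tendsto_integral_quadCutoff_mul {m : Measure (ℝ × ℝ)} (hm : IsIsoMeasure m)
    {g : ℝ × ℝ → ℝ} (hg : Integrable g m) :
    Tendsto (fun n : ℕ => ∫ η, quadCutoff ((n : ℝ) + 2) η * g η ∂m) atTop (𝓝 (∫ η, g η ∂m)) := by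
  have hae : ∀ᵐ η ∂m, η ∈ IsoRegion := hm
  refine tendsto_integral_of_dominated_convergence (fun η => ‖g η‖)
    (fun n => (contDiff_quadCutoff _).continuous.aestronglyMeasurable.mul hg.1) hg.norm
    (fun n => ae_of_all _ fun η => ?_) ?_
  · rw [norm_mul, Real.norm_of_nonneg (quadCutoff_nonneg _ _)]
    exact mul_le_of_le_one_left (norm_nonneg _) (quadCutoff_le_one _ _)
  · filter_upwards [hae] with η hη
    simpa using (tendsto_quadCutoff (IsoRegion_subset_Quad hη)).mul_const (g η)

theorem IsTestFun.add {ψ₁ ψ₂ : ℝ × (ℝ × ℝ) → ℝ} (h₁ : IsTestFun ψ₁) (h₂ : IsTestFun ψ₂) :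
    IsTestFun fun q => ψ₁ q + ψ₂ q :=
  ⟨h₁.1.add h₂.1, h₁.2.1.add h₂.2.1, fun q hq => by
    beta_reduce; rw [h₁.2.2 q hq, h₂.2.2 q hq, add_zero]⟩

theorem integrable_of_bounded_on_Quad {m : Measure (ℝ × ℝ)} [IsFiniteMeasure m]
    (hm : IsIsoMeasure m) {g : ℝ × ℝ → ℝ} (hg : ContinuousOn g Quad) {C : ℝ}
    (hC : ∀ η ∈ Quad, |g η| ≤ C) : Integrable g m := by
  have hae : ∀ᵐ η ∂m, η ∈ IsoRegion := hm
  have hmeas : AEStronglyMeasurable g m := by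
    refine (measurable_indicator_of_continuousOn hg
      isOpen_Quad.measurableSet).aestronglyMeasurable.congr ?_
    filter_upwards [hae] with η hη using indicator_of_mem (IsoRegion_subset_Quad hη) g
  refine (integrable_const C).mono' hmeas ?_
  filter_upwards [hae] with η hη using hC η (IsoRegion_subset_Quad hη)

/-- Two measures with the same (Bochner) integrals of test functions, one of them finite, have
the same integrals of bounded `C¹` functions. No finiteness of the second measure is needed. -/
theorem integral_eq_of_forall_isTestFun {m₀ m : Measure (ℝ × ℝ)} [IsFiniteMeasure m₀]
    (hm₀ : IsIsoMeasure m₀) (hm : IsIsoMeasure m)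
    (h : ∀ Θ, IsTestFun Θ → ∫ η, Θ (0, η) ∂m₀ = ∫ η, Θ (0, η) ∂m) {g : ℝ × ℝ → ℝ}
    (hg : ContDiffOn ℝ 1 g Quad) {C : ℝ} (hC : ∀ η ∈ Quad, |g η| ≤ C) :
    ∫ η, g η ∂m₀ = ∫ η, g η ∂m := by
  let b : ContDiffBump (0 : ℝ) := ⟨1, 2, one_pos, one_lt_two⟩
  have hb : b 0 = 1 := b.one_of_mem_closedBall (Metric.mem_closedBall_self zero_le_one)
  have htest : ∀ (n : ℕ) {φ : ℝ × ℝ → ℝ}, ContDiffOn ℝ 1 φ Quad →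
      IsTestFun fun q => b q.1 * (quadCutoff ((n : ℝ) + 2) q.2 * φ q.2) := fun n φ hφ =>
    isTestFun_cutoff (Φ := fun q => φ q.2) (by positivity) b isOpen_univ (subset_univ _)
      (hφ.comp contDiff_snd.contDiffOn fun q hq => hq.2)
  have hone : ContDiffOn ℝ 1 (fun _ : ℝ × ℝ => (1 : ℝ)) Quad := contDiffOn_const
  have hint₀ : Integrable g m₀ := integrable_of_bounded_on_Quad hm₀ hg.continuousOn hC
  by_cases hint : Integrable g m
  · refine tendsto_nhds_unique (tendsto_integral_quadCutoff_mul hm₀ hint₀)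
      ((tendsto_integral_quadCutoff_mul hm hint).congr fun n => ?_)
    simpa [hb] using (h _ (htest n hg)).symm
  have hmono : ∀ {m' : Measure (ℝ × ℝ)} {φ : ℝ × ℝ → ℝ} {k : ℕ}, Integrable φ m' →
      (∀ η, quadCutoff ((k : ℝ) + 2) η ≤ φ η) → Integrable (quadCutoff ((k : ℝ) + 2)) m' :=
    fun hφ hle => hφ.mono' (contDiff_quadCutoff _).continuous.aestronglyMeasurable
      (ae_of_all _ fun η => by
        rw [Real.norm_of_nonneg (quadCutoff_nonneg _ _)]; exact hle η)
  have hχ₀ : ∀ k : ℕ, Integrable (quadCutoff ((k : ℝ) + 2)) m₀ := fun k =>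
    hmono (integrable_const 1) fun η => quadCutoff_le_one _ η
  have hlim₀ := tendsto_integral_quadCutoff_mul hm₀ (integrable_const (1 : ℝ))
  simp only [mul_one] at hlim₀
  by_cases hall : ∀ k : ℕ, Integrable (quadCutoff ((k : ℝ) + 2)) m
  · refine absurd ?_ hint
    have hae : ∀ᵐ η ∂m, η ∈ IsoRegion := hm
    have hle : m univ ≤ m₀ univ := by
      calc m univ = ∫⁻ _, 1 ∂m := by simp
        _ = ∫⁻ η, liminf (fun n : ℕ => ENNReal.ofReal (quadCutoff ((n : ℝ) + 2) η)) atTop ∂m := by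
            refine lintegral_congr_ae ?_
            filter_upwards [hae] with η hη
            have := (ENNReal.continuous_ofReal.tendsto _).comp
              (tendsto_quadCutoff (IsoRegion_subset_Quad hη))
            rw [ENNReal.ofReal_one] at this
            exact this.liminf_eq.symm
        _ ≤ liminf (fun n : ℕ => ∫⁻ η, ENNReal.ofReal (quadCutoff ((n : ℝ) + 2) η) ∂m) atTop :=
            lintegral_liminf_le fun n =>
              (contDiff_quadCutoff _).continuous.measurable.ennreal_ofReal
        _ ≤ m₀ univ := by
            refine liminf_le_of_le (by isBoundedDefault) fun c hc => ?_
            obtain ⟨n, hn⟩ := hc.exists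
            refine hn.trans ?_
            have hn' : ∫ η, quadCutoff ((n : ℝ) + 2) η ∂m₀ = ∫ η, quadCutoff ((n : ℝ) + 2) η ∂m := by
              simpa [hb] using h _ (htest n hone)
            rw [← ofReal_integral_eq_lintegral_ofReal (hall n)
                (ae_of_all _ fun η => quadCutoff_nonneg _ η), ← hn',
              ofReal_integral_eq_lintegral_ofReal (hχ₀ n)
                (ae_of_all _ fun η => quadCutoff_nonneg _ η)]
            calc _ ≤ ∫⁻ _, 1 ∂m₀ := lintegral_mono fun η => by
                    simpa using ENNReal.ofReal_le_ofReal (quadCutoff_le_one ((n : ℝ) + 2) η)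
              _ = m₀ univ := by simp
    have : IsFiniteMeasure m := ⟨hle.trans_lt (measure_lt_top _ _)⟩
    exact integrable_of_bounded_on_Quad hm hg.continuousOn hC
  · obtain ⟨k, hk⟩ := not_forall.1 hall
    have hzero : ∀ n : ℕ, ∫ η, quadCutoff ((n : ℝ) + 2) η ∂m₀ = 0 := by
      intro n
      have hni : ¬ Integrable (fun η => quadCutoff ((n : ℝ) + 2) η + quadCutoff ((k : ℝ) + 2) η) m :=
        fun hi => hk (hmono hi fun η => le_add_of_nonneg_left (quadCutoff_nonneg _ _))
      have := h _ ((htest n hone).add (htest k hone))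
      simp only [hb, one_mul, mul_one] at this
      rw [integral_undef hni, integral_add (hχ₀ n) (hχ₀ k)] at this
      have h₁ : 0 ≤ ∫ η, quadCutoff ((n : ℝ) + 2) η ∂m₀ :=
        integral_nonneg fun η => quadCutoff_nonneg _ η
      have h₂ : 0 ≤ ∫ η, quadCutoff ((k : ℝ) + 2) η ∂m₀ :=
        integral_nonneg fun η => quadCutoff_nonneg _ η
      linarith
    simp only [hzero] at hlim₀
    have hu := tendsto_nhds_unique hlim₀ tendsto_const_nhds
    rw [integral_const, smul_eq_mul, mul_one, measureReal_eq_zero_iff] at hu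
    rw [Measure.measure_univ_eq_zero.1 hu, integral_zero_measure, integral_undef hint]

/-- The quadrant is closed under coagulation. -/
theorem add_mem_Quad {η η' : ℝ × ℝ} (h : η ∈ Quad) (h' : η' ∈ Quad) : η + η' ∈ Quad :=
  ⟨add_pos h.1 h'.1, add_pos h.2 h'.2⟩

theorem IsCoagKernel.abs_le {K : ℝ × ℝ → ℝ × ℝ → ℝ} {K₀ K₁ al be : ℝ}
    (hK : IsCoagKernel K K₀ K₁ al be) {η η' : ℝ × ℝ} (h : η ∈ Quad) (h' : η' ∈ Quad) :
    |K η η'| ≤ K₀ * ((η.2 ^ (-al) + η.2 ^ be) * (η'.2 ^ (-al) + η'.2 ^ be)) := by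
  have h₁ := Real.rpow_nonneg h.2.le (-al)
  have h₂ := Real.rpow_nonneg h.2.le be
  have h₃ := Real.rpow_nonneg h'.2.le (-al)
  have h₄ := Real.rpow_nonneg h'.2.le be
  have hK₁ := hK.K1_pos.le
  have hK₀ : 0 ≤ K₀ := hK₁.trans hK.K1_le_K0
  rw [abs_of_nonneg (le_trans (by positivity) (hK.lower η h η' h'))]
  refine (hK.upper η h η' h').trans (mul_le_mul_of_nonneg_left ?_ hK₀)
  nlinarith [mul_nonneg h₁ h₃, mul_nonneg h₂ h₄]

theorem IsFusionKernel.abs_mul_le {r : ℝ × ℝ → ℝ} {R₀ R₁ mu sg B : ℝ}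
    (hr : IsFusionKernel r R₀ R₁ mu sg B) (hmu : 0 < mu) {η : ℝ × ℝ} (hη : η ∈ IsoRegion)
    {d C : ℝ} (hC : 0 ≤ C) (hd : |η.1 * d| ≤ C * (η.1 + 1)) :
    |r η * (c0 * η.2 ^ ((2 : ℝ) / 3) - η.1) * d| ≤
      R₁ * C * (3 * (η.1 ^ (mu + 2) + η.2 ^ (max (sg * (mu + 2)) 2)
        + η.2 ^ (min (sg * (mu + 2)) (-1)))) := by
  have hq := IsoRegion_subset_Quad hη
  have h₀ : 0 ≤ c0 * η.2 ^ ((2 : ℝ) / 3) := mul_nonneg c0_pos.le (Real.rpow_nonneg hq.2.le _)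
  have h₁ : |c0 * η.2 ^ ((2 : ℝ) / 3) - η.1| ≤ η.1 := by
    rw [abs_le]; constructor <;> linarith [hη.2, hq.1]
  have hR := hr.R1_pos.le
  calc |r η * (c0 * η.2 ^ ((2 : ℝ) / 3) - η.1) * d|
      = r η * (|c0 * η.2 ^ ((2 : ℝ) / 3) - η.1| * |d|) := by
        rw [abs_mul, abs_mul, abs_of_pos (hr.pos η hq), mul_assoc]
    _ ≤ (R₁ * η.1 ^ mu * η.2 ^ sg) * (C * (η.1 + 1)) := by
        refine mul_le_mul (hr.upper η hq) ?_ (by positivity)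
          ((hr.pos η hq).le.trans (hr.upper η hq))
        refine (mul_le_mul_of_nonneg_right h₁ (abs_nonneg d)).trans ?_
        rwa [abs_mul, abs_of_pos hq.1] at hd
    _ = R₁ * C * (η.1 ^ mu * η.2 ^ sg * (η.1 + 1)) := by ring
    _ ≤ _ := mul_le_mul_of_nonneg_left (fusion_weight_le hmu hq.1 hq.2) (by positivity)

/-- extension of the class of admissible test functions — under the higher
moment bounds, the weak formulation of the ε-fusion problem holds for all C¹ test
functions, bounded together with their time- and a-derivatives, not necessarily
compactly supported. -/
theorem test_function_extension
    (K : ℝ × ℝ → ℝ × ℝ → ℝ) (K₀ K₁ al be : ℝ) (hK : IsCoagKernel K K₀ K₁ al be)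
    (r : ℝ × ℝ → ℝ) (R₀ R₁ mu sg B : ℝ) (hr : IsFusionKernel r R₀ R₁ mu sg B)
    (hmu : 0 < mu)
    (ε : ℝ) (hε : 0 < ε) (T : ℝ) (hT : 0 < T)
    (fin : Measure (ℝ × ℝ)) (hfin_iso : IsIsoMeasure fin)
    (f : ℝ → Measure (ℝ × ℝ))
    (hsol : IsWeakSolution K r ε⁻¹ al be fin f)
    (hmom : ∃ C : ℝ≥0∞, C ≠ ⊤ ∧ ∀ t ∈ Icc (0 : ℝ) T,
        (∫⁻ η : ℝ × ℝ, ENNReal.ofReal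
          (η.1 ^ (mu + 2) + η.2 ^ (max (sg * (mu + 2)) 2)
            + η.2 ^ (min (sg * (mu + 2)) (-1))) ∂(f t)) ≤ C) :
    ∀ ψ : ℝ × (ℝ × ℝ) → ℝ,
      ContDiffOn ℝ 1 ψ (Icc (0 : ℝ) T ×ˢ Quad) →
      (∃ Cb : ℝ, ∀ t ∈ Icc (0 : ℝ) T, ∀ η ∈ Quad,
        |deriv (fun u => ψ (u, η)) t| + |ψ (t, η)|
          + |da (fun p => ψ (t, p)) η| ≤ Cb) →
      ∀ t ∈ Icc (0 : ℝ) T, WeakIdentity K r ε⁻¹ fin f ψ t := by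
  intro ψ hψ ⟨Cb, hCb⟩ t ht
  obtain ⟨hiso, hcont, hlow, hweak⟩ := hsol
  obtain ⟨M₁, hM₁, hlow⟩ := hlow T hT
  obtain ⟨M₂, hM₂, hmom⟩ := hmom
  obtain ⟨Cχ, hCχ, hχ⟩ := exists_abs_mul_deriv_halfLineCutoff_le
  have h0T : (0 : ℝ) ∈ Icc 0 T := left_mem_Icc.2 hT.le
  have hIso : ∀ s ∈ Icc (0 : ℝ) T, ∀ᵐ η ∂(f s), η ∈ IsoRegion := fun s hs => hiso s hs.1
  have hQuad : ∀ s ∈ Icc (0 : ℝ) T, ∀ᵐ η ∂(f s), η ∈ Quad := fun s hs =>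
    (hIso s hs).mono fun _ h => IsoRegion_subset_Quad h
  have hψ' : ContDiffOn ℝ 1 ψ (Ioo 0 T ×ˢ Quad) :=
    hψ.mono (prod_mono Ioo_subset_Icc_self subset_rfl)
  -- bounds on `ψ` and its derivatives
  have hbt : ∀ s ∈ Icc (0 : ℝ) T, ∀ η ∈ Quad, |deriv (fun u => ψ (u, η)) s| ≤ Cb := by
    intro s hs η hη
    linarith [hCb s hs η hη, abs_nonneg (ψ (s, η)), abs_nonneg (da (fun p => ψ (s, p)) η)]
  have hb : ∀ s ∈ Icc (0 : ℝ) T, ∀ η ∈ Quad, |ψ (s, η)| ≤ Cb := by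
    intro s hs η hη
    linarith [hCb s hs η hη, abs_nonneg (deriv (fun u => ψ (u, η)) s),
      abs_nonneg (da (fun p => ψ (s, p)) η)]
  have hba : ∀ s ∈ Icc (0 : ℝ) T, ∀ η ∈ Quad, |da (fun p => ψ (s, p)) η| ≤ Cb := by
    intro s hs η hη
    linarith [hCb s hs η hη, abs_nonneg (deriv (fun u => ψ (u, η)) s), abs_nonneg (ψ (s, η))]
  have hCb₀ : 0 ≤ Cb := (abs_nonneg _).trans (hb 0 h0T (1, 1) ⟨one_pos, one_pos⟩)
  -- moments
  have hfinite : ∀ s ∈ Icc (0 : ℝ) T, f s univ ≤ M₂ := by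
    intro s hs
    refine le_trans ?_ (hmom s hs)
    rw [← lintegral_one]
    refine lintegral_mono_ae ?_
    filter_upwards [hQuad s hs] with η hη
    rw [← ENNReal.ofReal_one]
    exact ENNReal.ofReal_le_ofReal (one_le_moment_weight hη.1 hη.2
      (zero_le_two.trans (le_max_right _ _)) ((min_le_right _ _).trans (by norm_num)))
  have hfm : ∀ s ∈ Icc (0 : ℝ) T, IsFiniteMeasure (f s) := fun s hs =>
    ⟨(hfinite s hs).trans_lt hM₂.lt_top⟩
  set P : ℝ × ℝ → ℝ := fun η => η.2 ^ (-al) + η.2 ^ be with hP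
  set W : ℝ × ℝ → ℝ := fun η => η.1 ^ (mu + 2) + η.2 ^ (max (sg * (mu + 2)) 2)
    + η.2 ^ (min (sg * (mu + 2)) (-1)) with hW
  have hP₀ : ∀ η ∈ Quad, 0 ≤ P η := fun η hη =>
    add_nonneg (Real.rpow_nonneg hη.2.le _) (Real.rpow_nonneg hη.2.le _)
  have hW₀ : ∀ η ∈ Quad, 0 ≤ W η := fun η hη =>
    add_nonneg (add_nonneg (Real.rpow_nonneg hη.1.le _) (Real.rpow_nonneg hη.2.le _))
      (Real.rpow_nonneg hη.2.le _)
  have hPi : ∀ s ∈ Icc (0 : ℝ) T, Integrable P (f s) ∧ ∫ η, P η ∂(f s) ≤ M₁.toReal := fun s hs =>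
    integrable_and_integral_le_of_lintegral_le
      ((measurable_snd.pow_const _).add (measurable_snd.pow_const _))
      ((hQuad s hs).mono hP₀) hM₁ (hlow s hs)
  have hWi : ∀ s ∈ Icc (0 : ℝ) T, Integrable W (f s) ∧ ∫ η, W η ∂(f s) ≤ M₂.toReal := fun s hs =>
    integrable_and_integral_le_of_lintegral_le
      (((measurable_fst.pow_const _).add (measurable_snd.pow_const _)).add
        (measurable_snd.pow_const _))
      ((hQuad s hs).mono hW₀) hM₂ (hmom s hs)
  -- the solution as a kernel
  let κ : ProbabilityTheory.Kernel ℝ (ℝ × ℝ) :=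
    ⟨(Icc (0 : ℝ) T).indicator f, measurable_truncated_measure hfm hiso hcont⟩
  have hκ : ∀ s ∈ Icc (0 : ℝ) T, κ s = f s := fun s hs => indicator_of_mem hs f
  have hκfin : ProbabilityTheory.IsFiniteKernel κ := by
    refine ⟨M₂, hM₂.lt_top, fun s => ?_⟩
    by_cases hs : s ∈ Icc (0 : ℝ) T
    · rw [hκ s hs]; exact hfinite s hs
    · change (Icc (0 : ℝ) T).indicator f s univ ≤ M₂
      rw [indicator_of_notMem hs]; simp
  have hκ' : ∀ s ∈ Ioo (0 : ℝ) T, κ s = f s := fun s hs => hκ s (Ioo_subset_Icc_self hs)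
  have hκIso : ∀ s ∈ Ioo (0 : ℝ) T, ∀ᵐ η ∂(κ s), η ∈ IsoRegion := fun s hs => by
    rw [hκ' s hs]; exact hIso s (Ioo_subset_Icc_self hs)
  have hκ₂ : ∀ s ∈ Ioo (0 : ℝ) T, (ProbabilityTheory.Kernel.prod κ κ) s = (f s).prod (f s) :=
    fun s hs => by rw [ProbabilityTheory.Kernel.prod_apply, hκ' s hs]
  -- the approximating test functions
  have hN : ∀ n : ℕ, (2 : ℝ) ≤ n + 2 := fun n => by linarith [n.cast_nonneg (α := ℝ)]
  set Ψ : ℕ → ℝ × (ℝ × ℝ) → ℝ := fun n => approxTest hT (hN n) ψ with hΨ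
  have hΨt : ∀ n, IsTestFun (Ψ n) := fun n => isTestFun_approxTest hT (hN n) hψ'
  have hΨb : ∀ n, ∀ s ∈ Icc (0 : ℝ) T, ∀ η ∈ Quad, |Ψ n (s, η)| ≤ Cb := fun n s hs η hη =>
    abs_approxTest_le hT (hN n) hb hs hη
  have hΨl : ∀ s ∈ Icc (0 : ℝ) T, ∀ η ∈ Quad, Tendsto (fun n => Ψ n (s, η)) atTop (𝓝 (ψ (s, η))) :=
    fun s hs η hη => tendsto_approxTest hT hψ.continuousOn hs hη hN
  have hslice : ∀ s ∈ Icc (0 : ℝ) T, Tendsto (fun n => ∫ η, Ψ n (s, η) ∂(f s)) atTop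
      (𝓝 (∫ η, ψ (s, η) ∂(f s))) := by
    intro s hs
    have := hfm s hs
    refine tendsto_integral_of_dominated_convergence (fun _ => Cb) (fun n => ?_)
      (integrable_const _) (fun n => ?_) ?_
    · exact ((hΨt n).1.continuous.comp (by fun_prop)).aestronglyMeasurable
    · filter_upwards [hQuad s hs] with η hη using hΨb n s hs η hη
    · filter_upwards [hQuad s hs] with η hη using hΨl s hs η hη
  -- the initial datum
  have hinit : ∀ Θ, IsTestFun Θ → ∫ η, Θ (0, η) ∂(f 0) = ∫ η, Θ (0, η) ∂fin := by
    intro Θ hΘ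
    have := hweak Θ hΘ 0 le_rfl
    simp only [WeakIdentity, intervalIntegral.integral_same, mul_zero, sub_zero, add_zero] at this
    exact sub_eq_zero.1 this
  have hinitψ : ∫ η, ψ (0, η) ∂(f 0) = ∫ η, ψ (0, η) ∂fin := by
    have := hfm 0 h0T
    refine integral_eq_of_forall_isTestFun (hiso 0 le_rfl) hfin_iso hinit ?_ (hb 0 h0T)
    exact hψ.comp (contDiff_const.prodMk contDiff_id).contDiffOn fun η hη => ⟨h0T, hη⟩
  have hlim_init : Tendsto (fun n => ∫ η, Ψ n (0, η) ∂fin) atTop (𝓝 (∫ η, ψ (0, η) ∂fin)) := by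
    rw [← hinitψ]
    exact (hslice 0 h0T).congr fun n => hinit _ (hΨt n)
  -- the time derivative
  have hlim_time : Tendsto
      (fun n => ∫ s in (0 : ℝ)..t, ∫ η, deriv (fun u => Ψ n (u, η)) s ∂(f s)) atTop
      (𝓝 (∫ s in (0 : ℝ)..t, ∫ η, deriv (fun u => ψ (u, η)) s ∂(f s))) := by
    refine tendsto_intervalIntegral_integral_kernel κ measurableSet_IsoRegion ht hκIso
      (G := fun n s η => deriv (fun u => Ψ n (u, η)) s)
      (G' := fun s η => deriv (fun u => ψ (u, η)) s) (w := fun _ => Cb) (M := M₂.toReal * Cb)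
      (fun n => ?_) (fun s _ => integrable_const _) (fun s hs => ?_) (fun n s hs η hη => ?_)
      (fun s hs η hη => tendsto_deriv_approxTest hT hψ' hs (IsoRegion_subset_Quad hη) hN)
      (fun n s hs _ => by rw [hκ' s hs]) (fun s hs _ => by rw [hκ' s hs])
    · exact (continuousOn_deriv_time isOpen_Ioo (hΨt n).1.contDiffOn).mono
        (prod_mono subset_rfl IsoRegion_subset_Quad)
    · rw [hκ' s hs, integral_const, smul_eq_mul]
      exact mul_le_mul_of_nonneg_right
        (ENNReal.toReal_mono hM₂ (hfinite s (Ioo_subset_Icc_self hs))) hCb₀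
    · have hq := IsoRegion_subset_Quad hη
      have h₁ : (0 : ℝ) ≤ 1 - ((n : ℝ) + 2)⁻¹ :=
        sub_nonneg.2 (inv_le_one_of_one_le₀ (by linarith [hN n]))
      have h₂ : 1 - ((n : ℝ) + 2)⁻¹ ≤ 1 := sub_le_self _ (by positivity)
      have h₃ := hbt _ (Ioo_subset_Icc_self (timeShrink_mem hT (hN n)
        (Ioo_subset_Icc_self hs))) η hq
      simp only [hΨ]
      rw [deriv_approxTest hT (hN n) hψ' hs hq, abs_mul, abs_mul,
        abs_of_nonneg (quadCutoff_nonneg _ _), abs_of_nonneg h₁]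
      exact (mul_le_of_le_one_left (by positivity) (quadCutoff_le_one _ _)).trans
        ((mul_le_of_le_one_right (abs_nonneg _) h₂).trans h₃)
  -- coagulation
  have hlim_coag : Tendsto (fun n => ∫ s in (0 : ℝ)..t, (1 / 2) *
        ∫ η, ∫ η', K η η' * (Ψ n (s, η + η') - Ψ n (s, η) - Ψ n (s, η')) ∂(f s) ∂(f s)) atTop
      (𝓝 (∫ s in (0 : ℝ)..t, (1 / 2) *
        ∫ η, ∫ η', K η η' * (ψ (s, η + η') - ψ (s, η) - ψ (s, η')) ∂(f s) ∂(f s))) := by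
    have hiter : ∀ s ∈ Ioo (0 : ℝ) T, ∀ φ : ℝ × (ℝ × ℝ) → ℝ,
        Integrable (fun p : (ℝ × ℝ) × (ℝ × ℝ) =>
          K p.1 p.2 * (φ (s, p.1 + p.2) - φ (s, p.1) - φ (s, p.2)))
          ((ProbabilityTheory.Kernel.prod κ κ) s) →
        ∫ η, ∫ η', K η η' * (φ (s, η + η') - φ (s, η) - φ (s, η')) ∂(f s) ∂(f s) =
          ∫ p : (ℝ × ℝ) × (ℝ × ℝ), K p.1 p.2 * (φ (s, p.1 + p.2) - φ (s, p.1) - φ (s, p.2))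
            ∂((ProbabilityTheory.Kernel.prod κ κ) s) := by
      intro s hs φ hi
      have := hfm s (Ioo_subset_Icc_self hs)
      rw [hκ₂ s hs] at hi ⊢
      exact (integral_prod _ hi).symm
    simp only [intervalIntegral.integral_const_mul]
    refine Tendsto.const_mul _ ?_
    refine tendsto_intervalIntegral_integral_kernel (ProbabilityTheory.Kernel.prod κ κ)
      (isOpen_Quad.prod isOpen_Quad).measurableSet ht
      (G := fun n s p => K p.1 p.2 * (Ψ n (s, p.1 + p.2) - Ψ n (s, p.1) - Ψ n (s, p.2)))
      (G' := fun s p => K p.1 p.2 * (ψ (s, p.1 + p.2) - ψ (s, p.1) - ψ (s, p.2)))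
      (w := fun p => K₀ * (3 * Cb) * (P p.1 * P p.2))
      (M := K₀ * (3 * Cb) * (M₁.toReal * M₁.toReal))
      (fun s hs => ?_) (fun n => ?_) (fun s hs => ?_) (fun s hs => ?_) (fun n s hs p hp => ?_)
      (fun s hs p hp => ?_) (fun n s hs => hiter s hs (Ψ n)) (fun s hs => hiter s hs ψ)
    · rw [hκ₂ s hs]
      have := hfm s (Ioo_subset_Icc_self hs)
      have hq := hQuad s (Ioo_subset_Icc_self hs)
      filter_upwards [Measure.quasiMeasurePreserving_fst.ae hq,
        Measure.quasiMeasurePreserving_snd.ae hq] with p h₁ h₂ using ⟨h₁, h₂⟩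
    · have hc := (hΨt n).1.continuous
      refine ContinuousOn.mul (hK.cont.comp continuousOn_snd fun q hq => hq.2) ?_
      exact Continuous.continuousOn (((hc.comp (by fun_prop)).sub (hc.comp (by fun_prop))).sub
        (hc.comp (by fun_prop)))
    · rw [hκ₂ s hs]
      have := hfm s (Ioo_subset_Icc_self hs)
      have hi := (hPi s (Ioo_subset_Icc_self hs)).1
      exact (hi.mul_prod hi).const_mul _
    · rw [hκ₂ s hs]
      have := hfm s (Ioo_subset_Icc_self hs)
      have hi := (hPi s (Ioo_subset_Icc_self hs)).2
      have h₀ : 0 ≤ ∫ η, P η ∂(f s) :=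
        integral_nonneg_of_ae ((hQuad s (Ioo_subset_Icc_self hs)).mono hP₀)
      have hK₀ : 0 ≤ K₀ := hK.K1_pos.le.trans hK.K1_le_K0
      rw [integral_const_mul, integral_prod_mul]
      exact mul_le_mul_of_nonneg_left (mul_le_mul hi hi h₀ (h₀.trans hi)) (by positivity)
    · have hs' := Ioo_subset_Icc_self hs
      have h₁ := hΨb n s hs' _ (add_mem_Quad hp.1 hp.2)
      have h₂ := hΨb n s hs' _ hp.1
      have h₃ := hΨb n s hs' _ hp.2
      have h₄ : |Ψ n (s, p.1 + p.2) - Ψ n (s, p.1) - Ψ n (s, p.2)| ≤ 3 * Cb := by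
        rw [abs_le] at *; constructor <;> linarith [h₁.1, h₁.2, h₂.1, h₂.2, h₃.1, h₃.2]
      have hk := hK.abs_le hp.1 hp.2
      rw [abs_mul]
      calc _ ≤ K₀ * (P p.1 * P p.2) * (3 * Cb) :=
            mul_le_mul hk h₄ (abs_nonneg _) ((abs_nonneg _).trans hk)
        _ = _ := by ring
    · have hs' := Ioo_subset_Icc_self hs
      exact (((hΨl s hs' _ (add_mem_Quad hp.1 hp.2)).sub (hΨl s hs' _ hp.1)).sub
        (hΨl s hs' _ hp.2)).const_mul _
  -- fusion
  have hlim_fusion : Tendsto (fun n => ∫ s in (0 : ℝ)..t,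
        ∫ η, r η * (c0 * η.2 ^ ((2 : ℝ) / 3) - η.1) * da (fun p => Ψ n (s, p)) η ∂(f s)) atTop
      (𝓝 (∫ s in (0 : ℝ)..t,
        ∫ η, r η * (c0 * η.2 ^ ((2 : ℝ) / 3) - η.1) * da (fun p => ψ (s, p)) η ∂(f s))) := by
    have hC : 0 ≤ (Cχ + 1) * Cb := by positivity
    have hR := hr.R1_pos.le
    refine tendsto_intervalIntegral_integral_kernel κ measurableSet_IsoRegion ht hκIso
      (G := fun n s η => r η * (c0 * η.2 ^ ((2 : ℝ) / 3) - η.1) * da (fun p => Ψ n (s, p)) η)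
      (G' := fun s η => r η * (c0 * η.2 ^ ((2 : ℝ) / 3) - η.1) * da (fun p => ψ (s, p)) η)
      (w := fun η => R₁ * ((Cχ + 1) * Cb) * (3 * W η))
      (M := R₁ * ((Cχ + 1) * Cb) * (3 * M₂.toReal))
      (fun n => ?_) (fun s hs => ?_) (fun s hs => ?_) (fun n s hs η hη => ?_)
      (fun s hs η hη => (tendsto_da_approxTest hT hψ' hs
        (IsoRegion_subset_Quad hη) hN).const_mul _)
      (fun n s hs _ => by rw [hκ' s hs]) (fun s hs _ => by rw [hκ' s hs])
    · refine ContinuousOn.mul (ContinuousOn.mul ?_ ?_) ?_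
      · exact hr.smooth.continuousOn.comp continuousOn_snd fun q hq => IsoRegion_subset_Quad hq.2
      · have : Continuous fun x : ℝ => x ^ ((2 : ℝ) / 3) :=
          Real.continuous_rpow_const (by norm_num)
        fun_prop
      · exact (continuousOn_da isOpen_Ioo (hΨt n).1.contDiffOn).mono
          (prod_mono subset_rfl IsoRegion_subset_Quad)
    · rw [hκ' s hs]
      exact ((hWi s (Ioo_subset_Icc_self hs)).1.const_mul _).const_mul _
    · rw [hκ' s hs, integral_const_mul, integral_const_mul]
      have := (hWi s (Ioo_subset_Icc_self hs)).2
      gcongr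
    · have hq := IsoRegion_subset_Quad hη
      have hs' := timeShrink_mem hT (hN n) (Ioo_subset_Icc_self hs)
      have h₁ := hb _ (Ioo_subset_Icc_self hs') η hq
      have h₂ := hba _ (Ioo_subset_Icc_self hs') η hq
      have h₃ := hχ ((n : ℝ) + 2) η.1 (by positivity)
      refine hr.abs_mul_le hmu hη hC ?_
      simp only [hΨ]
      rw [da_approxTest hT (hN n) hψ' (Ioo_subset_Icc_self hs) hq, mul_add, ← mul_assoc,
        ← mul_assoc, ← mul_assoc]
      refine (abs_add_le _ _).trans ?_
      have e₁ : |η.1 * deriv (halfLineCutoff ((n : ℝ) + 2)) η.1 *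
          halfLineCutoff ((n : ℝ) + 2) η.2 * ψ (timeShrink T ((n : ℝ) + 2) s, η)| ≤ Cχ * Cb := by
        rw [abs_mul, abs_mul, abs_of_nonneg (halfLineCutoff_nonneg _ _)]
        exact mul_le_mul ((mul_le_of_le_one_right (abs_nonneg _)
          (halfLineCutoff_le_one _ _)).trans h₃) h₁ (abs_nonneg _) hCχ
      have e₂ : |η.1 * quadCutoff ((n : ℝ) + 2) η *
          da (fun p => ψ (timeShrink T ((n : ℝ) + 2) s, p)) η| ≤ η.1 * Cb := by
        rw [abs_mul, abs_mul, abs_of_nonneg (quadCutoff_nonneg _ _), abs_of_pos hq.1]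
        exact mul_le_mul (mul_le_of_le_one_right hq.1.le (quadCutoff_le_one _ _)) h₂
          (abs_nonneg _) hq.1.le
      nlinarith [mul_nonneg (mul_nonneg hCχ hCb₀) hq.1.le]
  exact tendsto_nhds_unique
    ((((hslice t ht).sub hlim_init).sub hlim_time).congr fun n => hweak _ (hΨt n) t ht.1)
    (hlim_coag.add (hlim_fusion.const_mul _))
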